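/- Let G be a group, K a field, and A a finite-dimensional G-graded K-algebra with J^gr(A) = 0. Then A is a direct sum of finitely many graded simple algebras; that is, A = B_1 ⊕ ⋯ ⊕ B_r where each B_i is a graded ideal of A which, as a graded algebra, is graded simple. -/

import Mathlib

/-!
STATEMENT 2: A finite-dimensional `G`-graded algebra over a field with `J^gr(A) = 0`
is the direct sum of finitely many graded ideals, each of which is a graded simple
algebra.
-/

universe u v w

variable (F : Type u) [Field F] (G : Type v) [Group G]
variable (A : Type w) [NonUnitalRing A] [Module F A]
  [SMulCommClass F A A] [IsScalarTower F A A]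

/-- `𝒜` is a `G`-grading of the (not necessarily unital) `F`-algebra `A`:
`A = ⊕_{g ∈ G} A_g` with `A_g A_h ⊆ A_{gh}`. -/
def IsAlgebraGrading (𝒜 : G → Submodule F A) : Prop :=
  iSupIndep 𝒜 ∧ (⨆ g, 𝒜 g) = ⊤ ∧
    ∀ ⦃g h : G⦄ ⦃x y : A⦄, x ∈ 𝒜 g → y ∈ 𝒜 h → x * y ∈ 𝒜 (g * h)

/-- A graded right `A`-module: a `G`-graded `F`-vector space `M = ⊕_g M_g` with a
right `A`-action (given as an `F`-bilinear map) satisfying `(m·a)·b = m·(ab)` and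
`M_g A_h ⊆ M_{gh}`. -/
structure GradedRightModule (𝒜 : G → Submodule F A) where
  M : Type w
  [acg : AddCommGroup M]
  [mod : Module F M]
  grading : G → Submodule F M
  indep : iSupIndep grading
  spans : (⨆ g, grading g) = ⊤
  act : M →ₗ[F] A →ₗ[F] M
  act_assoc : ∀ (m : M) (a b : A), act (act m a) b = act m (a * b)
  act_graded : ∀ ⦃g h : G⦄ ⦃m : M⦄ ⦃a : A⦄, m ∈ grading g → a ∈ 𝒜 h →
    act m a ∈ grading (g * h)

attribute [instance] GradedRightModule.acg GradedRightModule.mod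

variable {F G A}

/-- A graded submodule of a graded right module. -/
def GradedRightModule.IsGradedSubmodule {𝒜 : G → Submodule F A}
    (V : GradedRightModule F G A 𝒜) (N : Submodule F V.M) : Prop :=
  (∀ m ∈ N, ∀ a : A, V.act m a ∈ N) ∧ N = ⨆ g, N ⊓ V.grading g

/-- A graded right module is graded simple if `MA ≠ 0` and its only graded
submodules are `0` and `M`. -/
def GradedRightModule.IsGradedSimple {𝒜 : G → Submodule F A}
    (V : GradedRightModule F G A 𝒜) : Prop :=
  (∃ (m : V.M) (a : A), V.act m a ≠ 0) ∧
    ∀ N : Submodule F V.M, V.IsGradedSubmodule N → N = ⊥ ∨ N = ⊤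

variable (F G A) in
/-- The graded Jacobson radical: the intersection of the annihilators of all graded
simple right `A`-modules (equal to `A` when there is no such module). -/
def gradedJacobson (𝒜 : G → Submodule F A) : Submodule F A :=
  ⨅ (V : GradedRightModule F G A 𝒜) (_ : V.IsGradedSimple), LinearMap.ker V.act.flip

variable (F G A) in
/-- A graded (two-sided) ideal of the graded algebra `A`: an ideal `I` with
`I = ⊕_g (I ∩ A_g)`. -/
def IsGradedIdeal (𝒜 : G → Submodule F A) (I : Submodule F A) : Prop :=
  (∀ a : A, ∀ x ∈ I, a * x ∈ I ∧ x * a ∈ I) ∧ I = ⨆ g, I ⊓ 𝒜 g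

variable (F G A) in
/-- The subalgebra carried by the submodule `B`, equipped with the grading induced by
`𝒜`, is a graded simple algebra: `B² ≠ 0` and the only graded ideals of `B` are `0`
and `B`. -/
def IsGradedSimpleAlgebraOn (𝒜 : G → Submodule F A) (B : Submodule F A) : Prop :=
  (∃ x ∈ B, ∃ y ∈ B, x * y ≠ 0) ∧
    ∀ I : Submodule F A, I ≤ B →
      (∀ a ∈ B, ∀ x ∈ I, a * x ∈ I ∧ x * a ∈ I) →
      (I = ⨆ g, I ⊓ (B ⊓ 𝒜 g)) → I = ⊥ ∨ I = B

set_option linter.unusedSectionVars false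

section GradedSubspaces

theorem eq_iSup_inf_iff_decompose_mem [DecidableEq G] (𝒜 : G → Submodule F A)
    [DirectSum.Decomposition 𝒜] (I : Submodule F A) :
    (I = ⨆ g, I ⊓ 𝒜 g) ↔ ∀ x ∈ I, ∀ g, (DirectSum.decompose 𝒜 x g : A) ∈ I := by
  constructor
  · intro h x hx g
    rw [h] at hx
    induction hx using Submodule.iSup_induction' with
    | mem k y hy =>
      by_cases hk : k = g
      · subst hk
        rw [DirectSum.decompose_of_mem_same 𝒜 hy.2]
        exact hy.1
      · rw [DirectSum.decompose_of_mem_ne 𝒜 hy.2 hk]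
        exact I.zero_mem
    | zero => simp
    | add y z _ _ hy hz =>
      rw [DirectSum.decompose_add, DirectSum.add_apply, Submodule.coe_add]
      exact I.add_mem hy hz
  · classical
    intro h
    refine le_antisymm (fun x hx => ?_) (iSup_le fun g => inf_le_left)
    rw [← DirectSum.sum_support_decompose 𝒜 x]
    exact Submodule.sum_mem _ fun g _ =>
      Submodule.mem_iSup_of_mem g ⟨h x hx g, SetLike.coe_mem _⟩

theorem decompose_mul_of_left_mem [DecidableEq G] {𝒜 : G → Submodule F A}
    [DirectSum.Decomposition 𝒜]
    (hmul : ∀ ⦃g h : G⦄ ⦃x y : A⦄, x ∈ 𝒜 g → y ∈ 𝒜 h → x * y ∈ 𝒜 (g * h))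
    {g : G} {x : A} (hx : x ∈ 𝒜 g) (r : A) (h : G) :
    (DirectSum.decompose 𝒜 (x * r) (g * h) : A) = x * DirectSum.decompose 𝒜 r h := by
  induction r using DirectSum.Decomposition.inductionOn 𝒜 with
  | zero => simp
  | @homogeneous k m =>
    by_cases hk : k = h
    · subst hk
      rw [DirectSum.decompose_of_mem_same 𝒜 (hmul hx m.2),
        DirectSum.decompose_of_mem_same 𝒜 m.2]
    · rw [DirectSum.decompose_of_mem_ne 𝒜 (hmul hx m.2) (by simpa using hk),
        DirectSum.decompose_of_mem_ne 𝒜 m.2 hk, mul_zero]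
  | add y z hy hz =>
    simp only [mul_add, DirectSum.decompose_add, DirectSum.add_apply, Submodule.coe_add, hy, hz]

theorem decompose_mul_of_right_mem [DecidableEq G] {𝒜 : G → Submodule F A}
    [DirectSum.Decomposition 𝒜]
    (hmul : ∀ ⦃g h : G⦄ ⦃x y : A⦄, x ∈ 𝒜 g → y ∈ 𝒜 h → x * y ∈ 𝒜 (g * h))
    {h : G} {x : A} (hx : x ∈ 𝒜 h) (r : A) (g : G) :
    (DirectSum.decompose 𝒜 (r * x) (g * h) : A) = DirectSum.decompose 𝒜 r g * x := by
  induction r using DirectSum.Decomposition.inductionOn 𝒜 with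
  | zero => simp
  | @homogeneous k m =>
    by_cases hk : k = g
    · subst hk
      rw [DirectSum.decompose_of_mem_same 𝒜 (hmul m.2 hx),
        DirectSum.decompose_of_mem_same 𝒜 m.2]
    · rw [DirectSum.decompose_of_mem_ne 𝒜 (hmul m.2 hx) (by simpa using hk),
        DirectSum.decompose_of_mem_ne 𝒜 m.2 hk, zero_mul]
  | add y z hy hz =>
    simp only [add_mul, DirectSum.decompose_add, DirectSum.add_apply, Submodule.coe_add, hy, hz]

theorem iSup_eq_iSup_inf {ι : Sort*} (𝒜 : G → Submodule F A) {B : ι → Submodule F A}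
    (hB : ∀ i, B i = ⨆ g, B i ⊓ 𝒜 g) : (⨆ i, B i) = ⨆ g, (⨆ i, B i) ⊓ 𝒜 g := by
  refine le_antisymm (iSup_le fun i => ?_) (iSup_le fun g => inf_le_left)
  rw [hB i]
  exact iSup_mono fun g => inf_le_inf_right _ (le_iSup B i)

end GradedSubspaces

/-- A graded right ideal of the graded algebra `A`. -/
def IsGradedRightIdeal (𝒜 : G → Submodule F A) (I : Submodule F A) : Prop :=
  (∀ a : A, ∀ x ∈ I, x * a ∈ I) ∧ I = ⨆ g, I ⊓ 𝒜 g

theorem IsGradedIdeal.isGradedRightIdeal {𝒜 : G → Submodule F A} {I : Submodule F A}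
    (hI : IsGradedIdeal F G A 𝒜 I) : IsGradedRightIdeal 𝒜 I :=
  ⟨fun a x hx => (hI.1 a x hx).2, hI.2⟩

theorem IsGradedRightIdeal.eq_bot_of_mul_eq_zero {𝒜 : G → Submodule F A}
    (hJ : gradedJacobson F G A 𝒜 = ⊥) {R : Submodule F A} (hR : IsGradedRightIdeal 𝒜 R)
    (hsq : ∀ x ∈ R, ∀ y ∈ R, x * y = 0) : R = ⊥ := by
  rw [eq_bot_iff, ← hJ]
  refine le_iInf₂ fun V hV => ?_
  have hN : V.IsGradedSubmodule (Submodule.map₂ V.act ⊤ R) := by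
    constructor
    · intro m hm a
      have : Submodule.map₂ V.act ⊤ R ≤ (Submodule.map₂ V.act ⊤ R).comap (V.act.flip a) := by
        refine Submodule.map₂_le.2 fun v _ r hr => ?_
        rw [Submodule.mem_comap, LinearMap.flip_apply, V.act_assoc]
        exact Submodule.apply_mem_map₂ _ trivial (hR.1 a r hr)
      exact this hm
    · refine le_antisymm ?_ (iSup_le fun g => inf_le_left)
      conv_lhs => rw [← V.spans, hR.2, Submodule.map₂_iSup_left]
      refine iSup_le fun g => ?_
      rw [Submodule.map₂_iSup_right]
      refine iSup_le fun h => ?_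
      refine le_trans (le_inf (Submodule.map₂_le_map₂ le_top inf_le_left) ?_)
        (le_iSup (fun k => Submodule.map₂ V.act ⊤ R ⊓ V.grading k) (g * h))
      exact Submodule.map₂_le.2 fun v hv r hr => V.act_graded hv hr.2
  rcases hV.2 _ hN with h | h
  · intro r hr
    rw [LinearMap.mem_ker]
    ext v
    have : V.act v r ∈ Submodule.map₂ V.act ⊤ R := Submodule.apply_mem_map₂ _ trivial hr
    rw [h] at this
    simpa using this
  · exfalso
    have hVR : ∀ (v : V.M), ∀ r ∈ R, V.act v r = 0 := by
      intro v r hr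
      have : (⊤ : Submodule F V.M) ≤ LinearMap.ker (V.act.flip r) := by
        rw [← h]
        refine Submodule.map₂_le.2 fun w _ s hs => ?_
        rw [LinearMap.mem_ker, LinearMap.flip_apply, V.act_assoc, hsq s hs r hr, map_zero]
      exact this (Submodule.mem_top (x := v))
    obtain ⟨m, a, hma⟩ := hV.1
    have hbot : (⊤ : Submodule F V.M) ≤ ⊥ := by
      rw [← h]
      exact Submodule.map₂_le.2 fun v _ r hr => (Submodule.mem_bot F).2 (hVR v r hr)
    exact hma ((Submodule.mem_bot F).1 (hbot Submodule.mem_top))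

theorem exists_minimal_le [FiniteDimensional F A] (P : Submodule F A → Prop)
    {I : Submodule F A} (hI : P I) (hI0 : I ≠ ⊥) :
    ∃ B ≤ I, P B ∧ B ≠ ⊥ ∧ ∀ C, P C → C ≤ B → C = ⊥ ∨ C = B := by
  obtain ⟨B, ⟨hBI, hB, hB0⟩, hmin⟩ := wellFounded_lt.has_min
    {B : Submodule F A | B ≤ I ∧ P B ∧ B ≠ ⊥} ⟨I, le_rfl, hI, hI0⟩
  refine ⟨B, hBI, hB, hB0, fun C hC hCB => ?_⟩
  by_contra! h
  exact hmin C ⟨hCB.trans hBI, hC, h.1⟩ (lt_of_le_of_ne hCB h.2)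

section Idempotents

variable {𝒜 : G → Submodule F A}

theorem IsGradedRightIdeal.inf_ker_mulLeft (hgr : IsAlgebraGrading F G A 𝒜)
    {R : Submodule F A} (hR : IsGradedRightIdeal 𝒜 R) {g : G} {x : A} (hx : x ∈ 𝒜 g) :
    IsGradedRightIdeal 𝒜 (R ⊓ LinearMap.ker (LinearMap.mulLeft F x)) := by
  classical
  let _ := (DirectSum.isInternal_submodule_of_iSupIndep_of_iSup_eq_top
    hgr.1 hgr.2.1).chooseDecomposition
  refine ⟨fun a r hr => ⟨hR.1 a r hr.1, ?_⟩,
    (eq_iSup_inf_iff_decompose_mem 𝒜 _).2 fun r hr h =>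
      ⟨(eq_iSup_inf_iff_decompose_mem 𝒜 _).1 hR.2 r hr.1 h, ?_⟩⟩
  · have : x * r = 0 := hr.2
    simp [← mul_assoc, this]
  · have : x * r = 0 := hr.2
    rw [SetLike.mem_coe, LinearMap.mem_ker, LinearMap.mulLeft_apply, ← decompose_mul_of_left_mem hgr.2.2 hx, this]
    simp

theorem IsGradedRightIdeal.exists_idempotent [FiniteDimensional F A]
    (hgr : IsAlgebraGrading F G A 𝒜) (hJ : gradedJacobson F G A 𝒜 = ⊥)
    {I : Submodule F A} (hI : IsGradedRightIdeal 𝒜 I) (hI0 : I ≠ ⊥) :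
    ∃ e ∈ I, e ∈ 𝒜 1 ∧ e * e = e ∧ e ≠ 0 := by
  classical
  let _ := (DirectSum.isInternal_submodule_of_iSupIndep_of_iSup_eq_top
    hgr.1 hgr.2.1).chooseDecomposition
  obtain ⟨R, hRI, hR, hR0, hmin⟩ := exists_minimal_le (IsGradedRightIdeal 𝒜) hI hI0
  have hdec := (eq_iSup_inf_iff_decompose_mem 𝒜 _).1 hR.2
  obtain ⟨g, x, hxR, hxg, b, hb, hxb⟩ :
      ∃ g, ∃ x ∈ R, x ∈ 𝒜 g ∧ ∃ b ∈ R, x * b ≠ 0 := by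
    by_contra! h
    refine hR0 (hR.eq_bot_of_mul_eq_zero hJ fun x hx y hy => ?_)
    rw [← DirectSum.sum_support_decompose 𝒜 x, Finset.sum_mul]
    exact Finset.sum_eq_zero fun g _ => h g _ (hdec x hx g) (SetLike.coe_mem _) y hy
  have hxR_ideal : IsGradedRightIdeal 𝒜 (R.map (LinearMap.mulLeft F x)) := by
    constructor
    · rintro a _ ⟨r, hr, rfl⟩
      exact ⟨r * a, hR.1 a r hr, by simp [mul_assoc]⟩
    · refine (eq_iSup_inf_iff_decompose_mem 𝒜 _).2 ?_
      rintro _ ⟨r, hr, rfl⟩ k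
      refine ⟨_, hdec r hr (g⁻¹ * k), ?_⟩
      rw [LinearMap.mulLeft_apply, ← decompose_mul_of_left_mem hgr.2.2 hxg,
        mul_inv_cancel_left, LinearMap.mulLeft_apply]
  have hxR_eq : R.map (LinearMap.mulLeft F x) = R := by
    refine (hmin _ hxR_ideal ?_).resolve_left fun h => hxb ?_
    · rintro _ ⟨r, _, rfl⟩
      exact hR.1 r x hxR
    · have : x * b ∈ R.map (LinearMap.mulLeft F x) := ⟨b, hb, rfl⟩
      rw [h] at this
      simpa using this
  have hker : R ⊓ LinearMap.ker (LinearMap.mulLeft F x) = ⊥ := by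
    refine (hmin _ (hR.inf_ker_mulLeft hgr hxg) inf_le_left).resolve_right fun h => hxb ?_
    rw [← h] at hb
    exact hb.2
  obtain ⟨r, hr, hxr⟩ : x ∈ R.map (LinearMap.mulLeft F x) := hxR_eq.symm ▸ hxR
  rw [LinearMap.mulLeft_apply] at hxr
  have hxe : x * (DirectSum.decompose 𝒜 r 1 : A) = x := by
    rw [← decompose_mul_of_left_mem hgr.2.2 hxg, hxr, mul_one,
      DirectSum.decompose_of_mem_same 𝒜 hxg]
  have heR := hdec r hr 1
  refine ⟨_, hRI heR, SetLike.coe_mem _, ?_, fun h => hxb ?_⟩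
  · rw [← sub_eq_zero, ← Submodule.mem_bot F, ← hker]
    refine ⟨R.sub_mem (hR.1 _ _ heR) heR, ?_⟩
    rw [SetLike.mem_coe, LinearMap.mem_ker, LinearMap.mulLeft_apply, mul_sub, ← mul_assoc, hxe, hxe, sub_self]
  · rw [← hxe, h, mul_zero, zero_mul]

theorem IsGradedRightIdeal.exists_left_identity [FiniteDimensional F A]
    (hgr : IsAlgebraGrading F G A 𝒜) (hJ : gradedJacobson F G A 𝒜 = ⊥)
    {I : Submodule F A} (hI : IsGradedRightIdeal 𝒜 I) :
    ∃ e ∈ I, e ∈ 𝒜 1 ∧ ∀ b ∈ I, e * b = b := by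
  obtain ⟨_, ⟨e, ⟨heI, he1, hee⟩, rfl⟩, hmin⟩ := wellFounded_lt.has_min
    ((fun e => I ⊓ LinearMap.ker (LinearMap.mulLeft F e)) '' {e | e ∈ I ∧ e ∈ 𝒜 1 ∧ e * e = e})
    ⟨_, 0, ⟨I.zero_mem, (𝒜 1).zero_mem, mul_zero 0⟩, rfl⟩
  have hker : I ⊓ LinearMap.ker (LinearMap.mulLeft F e) = ⊥ := by
    by_contra h0
    obtain ⟨f, ⟨hfI, hef⟩, hf1, hff, hf0⟩ :=
      (hI.inf_ker_mulLeft hgr he1).exists_idempotent hgr hJ h0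
    rw [SetLike.mem_coe, LinearMap.mem_ker, LinearMap.mulLeft_apply] at hef
    have hfe : f * e ∈ 𝒜 1 := by simpa using hgr.2.2 hf1 he1
    have hef' : ∀ y, e * (f * y) = 0 := fun y => by rw [← mul_assoc, hef, zero_mul]
    have hff' : ∀ y, f * (f * y) = f * y := fun y => by rw [← mul_assoc, hff]
    have hee' : ∀ y, e * (e * y) = e * y := fun y => by rw [← mul_assoc, hee]
    refine hmin _ ⟨e + f - f * e, ⟨I.sub_mem (I.add_mem heI hfI) (hI.1 _ _ hfI),
      (𝒜 1).sub_mem ((𝒜 1).add_mem he1 hf1) hfe, ?_⟩, rfl⟩ ?_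
    · simp only [mul_sub, sub_mul, mul_add, add_mul, mul_assoc, hee, hef, hff, hef', hff',
        mul_zero]
      abel
    · refine lt_of_le_of_ne (fun b hb => ⟨hb.1, ?_⟩) fun h => hf0 ?_
      · have hb2 : (e + f - f * e) * b = 0 := hb.2
        have : e * ((e + f - f * e) * b) = e * b := by
          simp only [mul_sub, sub_mul, mul_add, add_mul, mul_assoc, hef', hee', add_zero,
            sub_zero]
        rw [SetLike.mem_coe, LinearMap.mem_ker, LinearMap.mulLeft_apply, ← this, hb2, mul_zero]
      · have hf : f ∈ I ⊓ LinearMap.ker (LinearMap.mulLeft F e) := ⟨hfI, hef⟩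
        replace hf := h.symm.le hf
        have hf2 : (e + f - f * e) * f = 0 := hf.2
        simpa only [sub_mul, add_mul, mul_assoc, hef, hff, mul_zero, zero_add, sub_zero] using hf2
  refine ⟨e, heI, he1, fun b hb => ?_⟩
  rw [← sub_eq_zero, ← Submodule.mem_bot F, ← hker]
  refine ⟨I.sub_mem (hI.1 _ _ heI) hb, ?_⟩
  rw [SetLike.mem_coe, LinearMap.mem_ker, LinearMap.mulLeft_apply, mul_sub, ← mul_assoc, hee, sub_self]

theorem IsGradedIdeal.exists_identity [FiniteDimensional F A]
    (hgr : IsAlgebraGrading F G A 𝒜) (hJ : gradedJacobson F G A 𝒜 = ⊥)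
    {B : Submodule F A} (hB : IsGradedIdeal F G A 𝒜 B) :
    ∃ e ∈ B, e ∈ 𝒜 1 ∧ ∀ b ∈ B, e * b = b ∧ b * e = b := by
  classical
  let _ := (DirectSum.isInternal_submodule_of_iSupIndep_of_iSup_eq_top
    hgr.1 hgr.2.1).chooseDecomposition
  obtain ⟨e, heB, he1, he⟩ := hB.isGradedRightIdeal.exists_left_identity hgr hJ
  have hL : IsGradedRightIdeal 𝒜 (B ⊓ LinearMap.ker (LinearMap.mulRight F e)) := by
    refine ⟨fun a l hl => ⟨(hB.1 a l hl.1).2, ?_⟩,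
      (eq_iSup_inf_iff_decompose_mem 𝒜 _).2 fun l hl g =>
        ⟨(eq_iSup_inf_iff_decompose_mem 𝒜 _).1 hB.2 l hl.1 g, ?_⟩⟩
    · have hle : l * e = 0 := hl.2
      rw [SetLike.mem_coe, LinearMap.mem_ker, LinearMap.mulRight_apply, mul_assoc, ← he _ (hB.1 a e heB).1,
        ← mul_assoc, hle, zero_mul]
    · have hle : l * e = 0 := hl.2
      rw [SetLike.mem_coe, LinearMap.mem_ker, LinearMap.mulRight_apply,
        ← decompose_mul_of_right_mem hgr.2.2 he1, hle]
      simp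
  have hL0 := hL.eq_bot_of_mul_eq_zero hJ fun x hx y hy => by
    have hxe : x * e = 0 := hx.2
    rw [← he y hy.1, ← mul_assoc, hxe, zero_mul]
  refine ⟨e, heB, he1, fun b hb => ⟨he b hb, ?_⟩⟩
  rw [← sub_eq_zero, ← Submodule.mem_bot F, ← hL0]
  refine ⟨B.sub_mem (hB.1 _ _ hb).2 hb, ?_⟩
  rw [SetLike.mem_coe, LinearMap.mem_ker, LinearMap.mulRight_apply, sub_mul, mul_assoc, he e heB, sub_self]

end Idempotents

/-- A minimal nonzero graded ideal of the graded algebra `A`. -/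
def IsMinimalGradedIdeal (𝒜 : G → Submodule F A) (B : Submodule F A) : Prop :=
  IsGradedIdeal F G A 𝒜 B ∧ B ≠ ⊥ ∧
    ∀ C : Submodule F A, IsGradedIdeal F G A 𝒜 C → C ≤ B → C = ⊥ ∨ C = B

section MinimalIdeals

variable {𝒜 : G → Submodule F A}

theorem IsGradedIdeal.inf (hgr : IsAlgebraGrading F G A 𝒜) {B C : Submodule F A}
    (hB : IsGradedIdeal F G A 𝒜 B) (hC : IsGradedIdeal F G A 𝒜 C) :
    IsGradedIdeal F G A 𝒜 (B ⊓ C) := by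
  classical
  let _ := (DirectSum.isInternal_submodule_of_iSupIndep_of_iSup_eq_top
    hgr.1 hgr.2.1).chooseDecomposition
  exact ⟨fun a x hx => ⟨⟨(hB.1 a x hx.1).1, (hC.1 a x hx.2).1⟩,
    ⟨(hB.1 a x hx.1).2, (hC.1 a x hx.2).2⟩⟩,
    (eq_iSup_inf_iff_decompose_mem 𝒜 _).2 fun x hx g =>
      ⟨(eq_iSup_inf_iff_decompose_mem 𝒜 _).1 hB.2 x hx.1 g,
        (eq_iSup_inf_iff_decompose_mem 𝒜 _).1 hC.2 x hx.2 g⟩⟩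

theorem IsGradedIdeal.iSup {ι : Sort*} {B : ι → Submodule F A}
    (hB : ∀ i, IsGradedIdeal F G A 𝒜 (B i)) : IsGradedIdeal F G A 𝒜 (⨆ i, B i) := by
  refine ⟨fun a x hx => ⟨?_, ?_⟩, iSup_eq_iSup_inf 𝒜 fun i => (hB i).2⟩
  · exact (iSup_le fun i y hy => Submodule.mem_iSup_of_mem i ((hB i).1 a y hy).1 :
      (⨆ i, B i) ≤ (⨆ i, B i).comap (LinearMap.mulLeft F a)) hx
  · exact (iSup_le fun i y hy => Submodule.mem_iSup_of_mem i ((hB i).1 a y hy).2 :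
      (⨆ i, B i) ≤ (⨆ i, B i).comap (LinearMap.mulRight F a)) hx

theorem IsGradedIdeal.exists_isCompl [FiniteDimensional F A]
    (hgr : IsAlgebraGrading F G A 𝒜) (hJ : gradedJacobson F G A 𝒜 = ⊥)
    {B : Submodule F A} (hB : IsGradedIdeal F G A 𝒜 B) :
    ∃ C, IsGradedIdeal F G A 𝒜 C ∧ IsCompl B C := by
  obtain ⟨e, heB, he1, he⟩ := hB.exists_identity hgr hJ
  have htop : IsGradedRightIdeal 𝒜 ⊤ := ⟨fun _ _ _ => trivial, by simp [hgr.2.1]⟩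
  have hC := htop.inf_ker_mulLeft hgr he1
  rw [top_inf_eq] at hC
  refine ⟨_, ⟨fun a x hx => ⟨?_, hC.1 a x hx⟩, hC.2⟩, ?_, ?_⟩
  · have hex : e * x = 0 := hx
    rw [LinearMap.mem_ker, LinearMap.mulLeft_apply, ← mul_assoc,
      ← (he _ (hB.1 a e heB).2).2, mul_assoc, hex, mul_zero]
  · rw [Submodule.disjoint_def]
    intro x hxB hx
    rw [← (he x hxB).1]
    exact hx
  · rw [codisjoint_iff, eq_top_iff]
    intro a _
    rw [← add_sub_cancel (e * a) a]
    refine Submodule.add_mem_sup (hB.1 a e heB).2 ?_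
    rw [LinearMap.mem_ker, LinearMap.mulLeft_apply, mul_sub, ← mul_assoc, (he e heB).1, sub_self]

theorem IsMinimalGradedIdeal.isGradedSimpleAlgebraOn [FiniteDimensional F A]
    (hgr : IsAlgebraGrading F G A 𝒜) (hJ : gradedJacobson F G A 𝒜 = ⊥)
    {B : Submodule F A} (hB : IsMinimalGradedIdeal 𝒜 B) :
    IsGradedSimpleAlgebraOn F G A 𝒜 B := by
  obtain ⟨hBi, hB0, hmin⟩ := hB
  obtain ⟨e, heB, -, he⟩ := hBi.exists_identity hgr hJ
  constructor
  · by_contra! h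
    exact hB0 (hBi.isGradedRightIdeal.eq_bot_of_mul_eq_zero hJ h)
  · intro I hIB hI hIg
    refine hmin I ⟨fun a x hx => ⟨?_, ?_⟩, ?_⟩ hIB
    · rw [← (he x (hIB hx)).1, ← mul_assoc]
      exact (hI _ (hBi.1 a e heB).1 x hx).1
    · rw [← (he x (hIB hx)).2, mul_assoc]
      exact (hI _ (hBi.1 a e heB).2 x hx).2
    · simpa only [← inf_assoc, inf_eq_left.2 hIB] using hIg

theorem sSupIndep_isMinimalGradedIdeal [FiniteDimensional F A]
    (hgr : IsAlgebraGrading F G A 𝒜) (hJ : gradedJacobson F G A 𝒜 = ⊥) :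
    sSupIndep {B | IsMinimalGradedIdeal 𝒜 B} := by
  intro B hB
  obtain ⟨e, heB, -, he⟩ := hB.1.exists_identity hgr hJ
  have hker : sSup ({B | IsMinimalGradedIdeal 𝒜 B} \ {B}) ≤
      LinearMap.ker (LinearMap.mulLeft F e) := by
    refine sSup_le ?_
    rintro C ⟨hC, hCB⟩ c hc
    have hinf : B ⊓ C = ⊥ := by
      by_contra h
      have hBC := hB.1.inf hgr hC.1
      exact hCB (((hC.2.2 _ hBC inf_le_right).resolve_left h).symm.trans
        ((hB.2.2 _ hBC inf_le_left).resolve_left h))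
    rw [LinearMap.mem_ker, LinearMap.mulLeft_apply, ← Submodule.mem_bot F, ← hinf]
    exact ⟨(hB.1.1 c e heB).2, (hC.1.1 e c hc).1⟩
  rw [Submodule.disjoint_def]
  intro x hxB hx
  rw [← (he x hxB).1]
  exact hker hx

theorem sSup_isMinimalGradedIdeal [FiniteDimensional F A]
    (hgr : IsAlgebraGrading F G A 𝒜) (hJ : gradedJacobson F G A 𝒜 = ⊥) :
    sSup {B | IsMinimalGradedIdeal 𝒜 B} = ⊤ := by
  have hT : IsGradedIdeal F G A 𝒜 (sSup {B | IsMinimalGradedIdeal 𝒜 B}) := by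
    rw [sSup_eq_iSup']
    exact IsGradedIdeal.iSup fun B => B.2.1
  obtain ⟨C, hC, hTC⟩ := hT.exists_isCompl hgr hJ
  have hC0 : C = ⊥ := by
    by_contra h0
    obtain ⟨B, hBC, hB⟩ := exists_minimal_le (IsGradedIdeal F G A 𝒜) hC h0
    exact hB.2.1 (le_bot_iff.1 (hTC.disjoint (le_sSup hB) hBC))
  simpa [hC0] using hTC.sup_eq_top

end MinimalIdeals

theorem gradedJacobson_eq_bot_decomposition (𝒜 : G → Submodule F A)
    (hgr : IsAlgebraGrading F G A 𝒜) [FiniteDimensional F A]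
    (hJ : gradedJacobson F G A 𝒜 = ⊥) :
    ∃ (r : ℕ) (B : Fin r → Submodule F A),
      iSupIndep B ∧ (⨆ i, B i) = ⊤ ∧
      ∀ i, IsGradedIdeal F G A 𝒜 (B i) ∧ IsGradedSimpleAlgebraOn F G A 𝒜 (B i) := by
  have hind := sSupIndep_isMinimalGradedIdeal hgr hJ
  have : Finite {B | IsMinimalGradedIdeal 𝒜 B} := WellFoundedGT.finite_of_sSupIndep hind
  obtain ⟨r, ⟨φ⟩⟩ := Finite.exists_equiv_fin {B | IsMinimalGradedIdeal 𝒜 B}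
  refine ⟨r, fun i => (φ.symm i : Submodule F A), ?_, ?_, fun i =>
    ⟨(φ.symm i).2.1, IsMinimalGradedIdeal.isGradedSimpleAlgebraOn hgr hJ (φ.symm i).2⟩⟩
  · exact ((sSupIndep_iff _).1 hind).comp φ.symm.injective
  · refine (φ.symm.iSup_comp
      (g := fun B : {B | IsMinimalGradedIdeal 𝒜 B} => (B : Submodule F A))).trans ?_
    rw [← sSup_eq_iSup']
    exact sSup_isMinimalGradedIdeal hgr hJ
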